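/- arXiv:hep-th/0504075 — 3 statements merged into one kernel-verified Lean document; each statement's English description precedes it below -/
import Mathlib

section
/- Let G be an additive abelian group and S : G × G → ℝ/ℤ a symmetric biadditive map (S(f,g) = S(g,f) for all f, g). Then there exists a map T : G → ℝ/ℤ such that S(f,g) = T(f+g) − T(f) − T(g) for all f, g ∈ G; consequently the central extension of G by 𝕋 determined by S via the twisted product is trivial. -/
/-- `e : ℝ/ℤ → 𝕋` is the isomorphism `e x = exp (2 π i x)`. -/
noncomputable def e : AddCircle (1 : ℝ) → Circle := AddCircle.toCircle

/-- The twisted product `(f,u)·(g,v) = (f+g, u·v·e(S(f,g)))` on `G × 𝕋`. -/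
noncomputable def tmul {G : Type*} [AddCommGroup G] (S : G → G → AddCircle (1 : ℝ))
    (p q : G × Circle) : G × Circle :=
  (p.1 + q.1, p.2 * q.2 * e (S p.1 q.1))

/-- The underlying set of the extension of `G` by `A` determined by the biadditive cocycle `S`. -/
@[ext]
structure CocycleExtension {G A : Type*} [AddCommGroup G] [AddCommGroup A]
    (S : G →+ G →+ A) where
  base : G
  fiber : A

namespace CocycleExtension

variable {G A : Type*} [AddCommGroup G] [AddCommGroup A] {S : G →+ G →+ A}

instance : Add (CocycleExtension S) :=
  ⟨fun p q => ⟨p.base + q.base, p.fiber + q.fiber + S p.base q.base⟩⟩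

instance : Zero (CocycleExtension S) := ⟨⟨0, 0⟩⟩

instance : Neg (CocycleExtension S) :=
  ⟨fun p => ⟨-p.base, -p.fiber + S p.base p.base⟩⟩

@[simp] lemma base_add (p q : CocycleExtension S) : (p + q).base = p.base + q.base := rfl

@[simp] lemma fiber_add (p q : CocycleExtension S) :
    (p + q).fiber = p.fiber + q.fiber + S p.base q.base := rfl

@[simp] lemma base_zero : (0 : CocycleExtension S).base = 0 := rfl

@[simp] lemma fiber_zero : (0 : CocycleExtension S).fiber = 0 := rfl

@[simp] lemma base_neg (p : CocycleExtension S) : (-p).base = -p.base := rfl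

@[simp] lemma fiber_neg (p : CocycleExtension S) :
    (-p).fiber = -p.fiber + S p.base p.base := rfl

/-- The extension determined by a symmetric biadditive cocycle is an abelian group. -/
abbrev addCommGroup (hS : ∀ f g, S f g = S g f) : AddCommGroup (CocycleExtension S) where
  add_assoc p q r := by
    ext
    · simp [add_assoc]
    · simp only [fiber_add, base_add, map_add, AddMonoidHom.add_apply]
      abel
  zero_add p := by ext <;> simp
  add_zero p := by ext <;> simp
  nsmul := nsmulRec
  zsmul := zsmulRec
  neg_add_cancel p := by ext <;> simp
  add_comm p q := by
    ext
    · simp [add_comm]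
    · simp [add_comm, hS p.base]

end CocycleExtension

/-- A symmetric biadditive cocycle with values in a divisible group is a coboundary. -/
theorem exists_coboundary_of_symmetric {G A : Type*} [AddCommGroup G] [AddCommGroup A]
    [DivisibleBy A ℤ] (S : G →+ G →+ A) (hS : ∀ f g, S f g = S g f) :
    ∃ T : G → A, ∀ f g, S f g = T (f + g) - T f - T g := by
  let := CocycleExtension.addCommGroup hS
  let i : A →+ CocycleExtension S :=
    { toFun := fun a => ⟨0, a⟩
      map_zero' := rfl
      map_add' := fun a b => by ext <;> simp }
  have hi : Function.Injective i := fun a b h => congrArg CocycleExtension.fiber h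
  obtain ⟨r, hr⟩ := (Module.Baer.of_divisible A).extension_property_addMonoidHom i hi
    (AddMonoidHom.id A)
  have hri (a : A) : r (i a) = a := DFunLike.congr_fun hr a
  refine ⟨fun f => -r ⟨f, 0⟩, fun f g => ?_⟩
  have key : (⟨f, 0⟩ + ⟨g, 0⟩ : CocycleExtension S) = i (S f g) + ⟨f + g, 0⟩ := by
    ext <;> simp [i]
  have h := congrArg r key
  rw [map_add, map_add, hri] at h
  rw [eq_sub_of_add_eq h.symm, sub_neg_eq_add, sub_neg_eq_add, sub_eq_neg_add, ← add_assoc]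

/-- If `S : G × G → ℝ/ℤ` is a symmetric biadditive map on an abelian group `G`, then
there is `T : G → ℝ/ℤ` with `S(f,g) = T(f+g) − T(f) − T(g)`; consequently the central
extension of `G` by `𝕋` determined by `S` via the twisted product is trivial, i.e. it
admits a homomorphic section. -/
theorem symmetric_cocycle_is_coboundary {G : Type*} [AddCommGroup G]
    (S : G → G → AddCircle (1 : ℝ))
    (hS_left : ∀ f f' g : G, S (f + f') g = S f g + S f' g)
    (hS_right : ∀ f g g' : G, S f (g + g') = S f g + S f g')
    (hS_symm : ∀ f g : G, S f g = S g f) :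
    (∃ T : G → AddCircle (1 : ℝ), ∀ f g : G, S f g = T (f + g) - T f - T g) ∧
    (∃ σ : G → G × Circle,
      (∀ f g : G, σ (f + g) = tmul S (σ f) (σ g)) ∧ (∀ f : G, (σ f).1 = f)) := by
  obtain ⟨T, hT⟩ := exists_coboundary_of_symmetric
    (AddMonoidHom.mk' (fun f => AddMonoidHom.mk' (S f) (hS_right f))
      fun f f' => AddMonoidHom.ext (hS_left f f')) hS_symm
  replace hT : ∀ f g : G, S f g = T (f + g) - T f - T g := hT
  refine ⟨⟨T, hT⟩, fun f => (f, e (T f)), fun f g => Prod.ext rfl ?_, fun _ => rfl⟩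
  simp only [tmul, e, ← AddCircle.toCircle_add, hT f g]
  congr 1
  abel
end

section
/- Let F, G : ℝ → ℝ be continuously differentiable with Δ_F = F(1) − F(0) ∈ ℤ and Δ_G = G(1) − G(0) ∈ ℤ, and let m, n ∈ ℤ. Then S(F + m, G + n) − S(F, G) ∈ ℤ, where F + m denotes the function t ↦ F(t) + m; i.e. the value S(F,G) mod ℤ depends only on the loops e^{2πiF} and e^{2πiG} and not on the chosen lifts. -/
/-- Gawędzki's formula `S(F,G) = ∫₀¹ F(t) G'(t) dt − (F(1) − F(0))·G(0)`. -/
noncomputable def Sgaw (F G : ℝ → ℝ) : ℝ :=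
  (∫ t in (0:ℝ)..1, F t * deriv G t) - (F 1 - F 0) * G 0

/-- If `F, G : ℝ → ℝ` are C¹ with `F(1) − F(0) ∈ ℤ` and `G(1) − G(0) ∈ ℤ`, and
`m, n ∈ ℤ`, then `S(F + m, G + n) − S(F, G) ∈ ℤ`: the value `S(F,G) mod ℤ` depends only
on the loops `e^{2πiF}`, `e^{2πiG}` and not on the chosen lifts. -/
theorem Sgaw_well_defined_mod_int (F G : ℝ → ℝ)
    (hF : ContDiff ℝ 1 F) (hG : ContDiff ℝ 1 G)
    (hΔF : ∃ k : ℤ, F 1 - F 0 = k) (hΔG : ∃ k : ℤ, G 1 - G 0 = k) (m n : ℤ) :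
    ∃ k : ℤ, Sgaw (fun t => F t + m) (fun t => G t + n) - Sgaw F G = k := by
  obtain ⟨a, ha⟩ := hΔF
  obtain ⟨b, hb⟩ := hΔG
  have hG' : Continuous (deriv G) := hG.continuous_deriv le_rfl
  have hint : ∫ t in (0:ℝ)..1, deriv G t = G 1 - G 0 :=
    intervalIntegral.integral_deriv_eq_sub
      (fun t _ => (hG.differentiable one_ne_zero).differentiableAt)
      (hG'.intervalIntegrable 0 1)
  have hsplit : ∫ t in (0:ℝ)..1, (F t + m) * deriv G t =
      (∫ t in (0:ℝ)..1, F t * deriv G t) + m * (G 1 - G 0) := by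
    have h₁ : IntervalIntegrable (fun t => F t * deriv G t) MeasureTheory.volume 0 1 :=
      (hF.continuous.mul hG').intervalIntegrable 0 1
    have h₂ : IntervalIntegrable (fun t => (m : ℝ) * deriv G t) MeasureTheory.volume 0 1 :=
      (continuous_const.mul hG').intervalIntegrable 0 1
    simp_rw [add_mul]
    rw [intervalIntegral.integral_add h₁ h₂, intervalIntegral.integral_const_mul, hint]
  refine ⟨m * b - a * n, ?_⟩
  simp only [Sgaw, deriv_add_const, hsplit, hb]
  push_cast
  linear_combination (-(n : ℝ)) * ha
end

section
/- Let f, g : ℝ² → ℂ be continuously differentiable with compact support, let U ⊆ ℝ² be a measurable set, and suppose f satisfies the Cauchy–Riemann equation ∂₂f(p) = i·∂₁f(p) for every p ∈ U. Then Γ(f,g) = −2π·∫_U (∂₁f + i·∂₂f)·(∂₁g − i·∂₂g) = 0, and consequently exp(E(f+g)) = exp(2πi·S(f,g))·exp(E(f))·exp(E(g)), where E(f) = π·∫_U ((∂₁f)² + (∂₂f)²) and S(f,g) = ∫_U (∂₁f·∂₂g − ∂₂f·∂₁g). -/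
open MeasureTheory

/-- First partial derivative `∂₁ f` of `f : ℝ² → ℂ`. -/
noncomputable def pd1 (f : ℝ × ℝ → ℂ) (p : ℝ × ℝ) : ℂ := fderiv ℝ f p (1, 0)

/-- Second partial derivative `∂₂ f` of `f : ℝ² → ℂ`. -/
noncomputable def pd2 (f : ℝ × ℝ → ℂ) (p : ℝ × ℝ) : ℂ := fderiv ℝ f p (0, 1)

/-- The energy term `E(f) = π·∫_U ((∂₁f)² + (∂₂f)²)` (complex squares, no conjugation). -/
noncomputable def Efun (U : Set (ℝ × ℝ)) (f : ℝ × ℝ → ℂ) : ℂ :=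
  (Real.pi : ℂ) * ∫ p in U, ((pd1 f p) ^ 2 + (pd2 f p) ^ 2)

/-- The cocycle `S(f,g) = ∫_U (∂₁f·∂₂g − ∂₂f·∂₁g)`. -/
noncomputable def Sfun (U : Set (ℝ × ℝ)) (f g : ℝ × ℝ → ℂ) : ℂ :=
  ∫ p in U, (pd1 f p * pd2 g p - pd2 f p * pd1 g p)

/-- `Γ(f,g) = −2π·∫_U (∂₁f + i·∂₂f)·(∂₁g − i·∂₂g)`. -/
noncomputable def Γfun (U : Set (ℝ × ℝ)) (f g : ℝ × ℝ → ℂ) : ℂ :=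
  (-2 * (Real.pi : ℂ)) *
    ∫ p in U, (pd1 f p + Complex.I * pd2 f p) * (pd1 g p - Complex.I * pd2 g p)

theorem continuous_pd1 {f : ℝ × ℝ → ℂ} (hf : ContDiff ℝ 1 f) : Continuous (pd1 f) :=
  (hf.continuous_fderiv one_ne_zero).clm_apply continuous_const

theorem continuous_pd2 {f : ℝ × ℝ → ℂ} (hf : ContDiff ℝ 1 f) : Continuous (pd2 f) :=
  (hf.continuous_fderiv one_ne_zero).clm_apply continuous_const

theorem HasCompactSupport.pd1 {f : ℝ × ℝ → ℂ} (hf : HasCompactSupport f) :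
    HasCompactSupport (pd1 f) :=
  hf.fderiv_apply ℝ (1, 0)

theorem HasCompactSupport.pd2 {f : ℝ × ℝ → ℂ} (hf : HasCompactSupport f) :
    HasCompactSupport (pd2 f) :=
  hf.fderiv_apply ℝ (0, 1)

theorem integrable_mul_of_hasCompactSupport {u v : ℝ × ℝ → ℂ} (hu : Continuous u)
    (hv : Continuous v) (huc : HasCompactSupport u) : Integrable (fun p => u p * v p) :=
  (hu.mul hv).integrable_of_hasCompactSupport huc.mul_right

theorem integrable_pd1_sq_add_pd2_sq {f : ℝ × ℝ → ℂ} (hf : ContDiff ℝ 1 f)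
    (hfc : HasCompactSupport f) : Integrable (fun p => pd1 f p ^ 2 + pd2 f p ^ 2) := by
  simp only [pow_two]
  exact (integrable_mul_of_hasCompactSupport (continuous_pd1 hf) (continuous_pd1 hf) hfc.pd1).add
    (integrable_mul_of_hasCompactSupport (continuous_pd2 hf) (continuous_pd2 hf) hfc.pd2)

theorem integrable_pd1_mul_pd2_sub {f g : ℝ × ℝ → ℂ} (hf : ContDiff ℝ 1 f)
    (hfc : HasCompactSupport f) (hg : ContDiff ℝ 1 g) :
    Integrable (fun p => pd1 f p * pd2 g p - pd2 f p * pd1 g p) :=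
  (integrable_mul_of_hasCompactSupport (continuous_pd1 hf) (continuous_pd2 hg) hfc.pd1).sub
    (integrable_mul_of_hasCompactSupport (continuous_pd2 hf) (continuous_pd1 hg) hfc.pd2)

theorem pd1_add {f g : ℝ × ℝ → ℂ} (hf : Differentiable ℝ f) (hg : Differentiable ℝ g)
    (p : ℝ × ℝ) : pd1 (fun q => f q + g q) p = pd1 f p + pd1 g p := by
  simp only [pd1]
  rw [fderiv_fun_add (hf p) (hg p)]
  rfl

theorem pd2_add {f g : ℝ × ℝ → ℂ} (hf : Differentiable ℝ f) (hg : Differentiable ℝ g)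
    (p : ℝ × ℝ) : pd2 (fun q => f q + g q) p = pd2 f p + pd2 g p := by
  simp only [pd2]
  rw [fderiv_fun_add (hf p) (hg p)]
  rfl

theorem Γfun_eq_zero_of_chiral {f : ℝ × ℝ → ℂ} (g : ℝ × ℝ → ℂ) {U : Set (ℝ × ℝ)}
    (hCR : ∀ p ∈ U, pd2 f p = Complex.I * pd1 f p) : Γfun U f g = 0 := by
  rw [Γfun, setIntegral_eq_zero_of_forall_eq_zero, mul_zero]
  intro p hp
  rw [hCR p hp]
  linear_combination
    (pd1 f p * (pd1 g p - Complex.I * pd2 g p)) * Complex.I_mul_I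

theorem Efun_add_of_chiral {f g : ℝ × ℝ → ℂ}
    (hf : ContDiff ℝ 1 f) (hfc : HasCompactSupport f)
    (hg : ContDiff ℝ 1 g) (hgc : HasCompactSupport g)
    {U : Set (ℝ × ℝ)} (hU : MeasurableSet U)
    (hCR : ∀ p ∈ U, pd2 f p = Complex.I * pd1 f p) :
    Efun U (fun p => f p + g p) =
      2 * (Real.pi : ℂ) * Complex.I * Sfun U f g + Efun U f + Efun U g := by
  have h_integral : (∫ p in U, (pd1 (fun q => f q + g q) p ^ 2 + pd2 (fun q => f q + g q) p ^ 2)) =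
      2 * Complex.I * (∫ p in U, (pd1 f p * pd2 g p - pd2 f p * pd1 g p)) +
        (∫ p in U, (pd1 f p ^ 2 + pd2 f p ^ 2)) + ∫ p in U, (pd1 g p ^ 2 + pd2 g p ^ 2) := by
    have hS := (integrable_pd1_mul_pd2_sub hf hfc hg).integrableOn (s := U)
    have hEf := (integrable_pd1_sq_add_pd2_sq hf hfc).integrableOn (s := U)
    have hEg := (integrable_pd1_sq_add_pd2_sq hg hgc).integrableOn (s := U)
    rw [← integral_const_mul, ← integral_add (hS.const_mul _) hEf,
      ← integral_add ((hS.const_mul _).fun_add hEf) hEg]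
    refine setIntegral_congr_fun hU fun p hp => ?_
    have hfd := hf.differentiable one_ne_zero
    have hgd := hg.differentiable one_ne_zero
    simp only [pd1_add hfd hgd, pd2_add hfd hgd, hCR p hp]
    linear_combination (2 * pd1 f p * pd1 g p) * Complex.I_mul_I
  simp only [Efun, Sfun, h_integral]
  ring

/-- If in addition `f` satisfies the Cauchy–Riemann (chirality) equation
`∂₂f = i·∂₁f` on `U`, then `Γ(f,g) = 0` and consequently
`exp(E(f+g)) = exp(2πi·S(f,g))·exp(E(f))·exp(E(g))`. -/
theorem reciprocity_chiral_splitting (f g : ℝ × ℝ → ℂ)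
    (hf : ContDiff ℝ 1 f) (hfc : HasCompactSupport f)
    (hg : ContDiff ℝ 1 g) (hgc : HasCompactSupport g)
    (U : Set (ℝ × ℝ)) (hU : MeasurableSet U)
    (hCR : ∀ p ∈ U, pd2 f p = Complex.I * pd1 f p) :
    Γfun U f g = 0 ∧
    Complex.exp (Efun U (fun p => f p + g p)) =
      Complex.exp (2 * (Real.pi : ℂ) * Complex.I * Sfun U f g) *
        Complex.exp (Efun U f) * Complex.exp (Efun U g) := by
  refine ⟨Γfun_eq_zero_of_chiral g hCR, ?_⟩
  rw [Efun_add_of_chiral hf hfc hg hgc hU hCR, Complex.exp_add, Complex.exp_add]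
end
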